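/- Let R be a commutative ring, s ∈ R, q = s², and let A = (a_{ij}) be an n×n matrix over R. Then the ordinary determinant of the n×n matrix whose (i,j)-entry is s^{(i−j)²}·a_{ij} equals the bigrassmannian determinant of A: det( s^{(i−j)²} a_{ij} ) = Σ_{w ∈ S_n} (−1)^{ℓ(w)} q^{β(w)} ∏_{i=1}^{n} a_{i,w(i)}. -/

import Mathlib

/-- The length ℓ(w) = |N(w)|, the number of inversions of `w`, where
N(w) = {(i,j) : i < j and w⁻¹(i) > w⁻¹(j)}. -/
def permLen {n : ℕ} (w : Equiv.Perm (Fin n)) : ℕ :=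
  (Finset.univ.filter
    (fun p : Fin n × Fin n => p.1 < p.2 ∧ w⁻¹ p.2 < w⁻¹ p.1)).card

/-- The bigrassmannian statistic β(w) = Σ_{(i,j)∈N(w)} (j−i). -/
def permBeta {n : ℕ} (w : Equiv.Perm (Fin n)) : ℕ :=
  ∑ p ∈ Finset.univ.filter
      (fun p : Fin n × Fin n => p.1 < p.2 ∧ w⁻¹ p.2 < w⁻¹ p.1),
    ((p.2 : ℕ) - (p.1 : ℕ))

theorem permBeta_cast_eq_sum {n : ℕ} (w : Equiv.Perm (Fin n)) :
    (permBeta w : ℤ) = ∑ j : Fin n, (j : ℤ) * ((j : ℤ) - (w⁻¹ j : Fin n)) := by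
  have card_lt (k : Fin n) : ∑ i : Fin n, (if i < k then (1 : ℤ) else 0) = k := by
    rw [Finset.sum_boole, Finset.filter_gt_eq_Iio, Fin.card_Iio]
  have indicator_sub (i j : Fin n) :
      (if i < j ∧ w⁻¹ j < w⁻¹ i then (1 : ℤ) else 0) - (if j < i ∧ w⁻¹ i < w⁻¹ j then 1 else 0)
        = (if i < j then 1 else 0) - (if w⁻¹ i < w⁻¹ j then 1 else 0) := by
    rcases lt_trichotomy i j with h | h | h
    · rcases lt_or_gt_of_ne ((w⁻¹).injective.ne h.ne) with h' | h' <;>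
        simp only [h, h', h.not_gt, h'.not_gt, and_self, and_false, false_and, if_true, if_false,
          sub_self, sub_zero]
    · simp [h]
    · rcases lt_or_gt_of_ne ((w⁻¹).injective.ne h.ne') with h' | h' <;>
        simp only [h, h', h.not_gt, h'.not_gt, and_self, and_false, false_and, if_true, if_false,
          sub_self, zero_sub]
  have expand : (permBeta w : ℤ) = ∑ i : Fin n, ∑ j : Fin n,
      (if i < j ∧ w⁻¹ j < w⁻¹ i then (1 : ℤ) else 0) * ((j : ℤ) - (i : ℤ)) := by
    rw [permBeta, Finset.sum_filter, Fintype.sum_prod_type]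
    push_cast
    refine Finset.sum_congr rfl fun i _ => Finset.sum_congr rfl fun j _ => ?_
    split_ifs with h
    · rw [Nat.cast_sub h.1.le, one_mul]
    · simp
  have inner_sum (j : Fin n) :
      ∑ i : Fin n, ((if i < j then (1 : ℤ) else 0) - (if w⁻¹ i < w⁻¹ j then 1 else 0))
        = (j : ℤ) - (w⁻¹ j : Fin n) := by
    rw [Finset.sum_sub_distrib, card_lt,
      Equiv.sum_comp w⁻¹ (fun i => if i < w⁻¹ j then (1 : ℤ) else 0), card_lt]
  simp_rw [expand, mul_sub, Finset.sum_sub_distrib]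
  rw [Finset.sum_comm, ← Finset.sum_sub_distrib, ← Finset.sum_sub_distrib]
  refine Finset.sum_congr rfl fun j _ => ?_
  rw [← mul_sub, ← inner_sum j, Finset.mul_sum, ← Finset.sum_sub_distrib]
  refine Finset.sum_congr rfl fun i _ => ?_
  rw [← indicator_sub i j]
  ring

theorem sum_natAbs_sub_sq_eq_two_mul_permBeta {n : ℕ} (w : Equiv.Perm (Fin n)) :
    ∑ i : Fin n, ((i : ℤ) - (w i : ℤ)).natAbs ^ 2 = 2 * permBeta w := by
  zify
  simp only [sq_abs]
  have sum_sq : ∑ i : Fin n, ((w⁻¹ i : Fin n) : ℤ) ^ 2 = ∑ i : Fin n, (i : ℤ) ^ 2 :=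
    Equiv.sum_comp w⁻¹ (fun i => (i : ℤ) ^ 2)
  have reindex : ∑ i : Fin n, ((i : ℤ) - (w i : ℤ)) ^ 2
      = ∑ i : Fin n, (((w⁻¹ i : Fin n) : ℤ) - (i : ℤ)) ^ 2 := by
    rw [← Equiv.sum_comp w⁻¹]
    simp
  rw [reindex, permBeta_cast_eq_sum]
  simp only [sub_sq, mul_sub, Finset.sum_add_distrib, Finset.sum_sub_distrib, sum_sq,
    Finset.mul_sum]
  rw [← sub_eq_zero]
  simp only [← Finset.sum_sub_distrib, ← Finset.sum_add_distrib]
  exact Finset.sum_eq_zero fun i _ => by ring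

theorem neg_one_pow_permLen {n : ℕ} (w : Equiv.Perm (Fin n)) :
    (-1 : ℤˣ) ^ permLen w = Equiv.Perm.sign w := by
  rw [← Equiv.Perm.sign_inv, Equiv.Perm.sign_eq_prod_prod_Ioi, permLen, ← Finset.prod_const,
    Finset.prod_filter, Fintype.prod_prod_type]
  refine Finset.prod_congr rfl fun i _ => ?_
  rw [← Finset.filter_lt_eq_Ioi, Finset.prod_filter]
  refine Finset.prod_congr rfl fun j _ => ?_
  by_cases h : i < j
  · rcases lt_or_gt_of_ne ((w⁻¹).injective.ne h.ne) with h' | h' <;>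
      simp only [h, h', h'.not_gt, and_self, and_false, if_true, if_false]
  · simp [h]

/-- for a commutative ring R, s ∈ R, q = s², and an n×n matrix A,
det( s^{(i−j)²} a_{ij} ) = Σ_{w ∈ S_n} (−1)^{ℓ(w)} q^{β(w)} ∏_i a_{i,w(i)}
(the bigrassmannian determinant of A). -/
theorem signed_bigrassmannian_stmt10 {R : Type*} [CommRing R] (s q : R)
    (hq : q = s ^ 2) (n : ℕ) (A : Matrix (Fin n) (Fin n) R) :
    (Matrix.of fun i j : Fin n =>
        s ^ (((i : ℤ) - (j : ℤ)).natAbs ^ 2) * A i j).det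
      = ∑ w : Equiv.Perm (Fin n),
          (-1 : R) ^ permLen w * q ^ permBeta w * ∏ i : Fin n, A i (w i) := by
  rw [← Matrix.det_transpose, Matrix.det_apply']
  refine Finset.sum_congr rfl fun w _ => ?_
  simp only [Matrix.transpose_apply, Matrix.of_apply]
  rw [Finset.prod_mul_distrib, Finset.prod_pow_eq_pow_sum,
    sum_natAbs_sub_sq_eq_two_mul_permBeta, pow_mul, ← hq, ← neg_one_pow_permLen]
  push_cast
  ring
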